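/- Let (V, C, e) be an operator system and let p_1, …, p_N ∈ V be positive contractions. Then I_{2^N} ⊗ e is an Archimedean matrix order unit for (M_{2^N}(V), C(p_1, …, p_N)): (i) for every n and every hermitian x ∈ M_{n·2^N}(V) there exists t > 0 such that x + t·(I_{n·2^N} ⊗ e) ∈ C(p_1, …, p_N)_n; (ii) for every n and hermitian x ∈ M_{n·2^N}(V), if x + ε·(I_{n·2^N} ⊗ e) ∈ C(p_1, …, p_N)_n for all ε > 0, then x ∈ C(p_1, …, p_N)_n. -/

import Mathlib

open scoped ComplexOrder

/-- `x` is a hermitian matrix over a ∗-vector space. -/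
def IsHermMat {V ι : Type} [Star V] (x : Matrix ι ι V) : Prop :=
  ∀ i j, x j i = star (x i j)

/-- A family of cones of matrices over `V`, one for each finite matrix-index type. -/
abbrev ConeFamily (V : Type) : Type 1 :=
  ∀ (ι : Type) [Fintype ι] [DecidableEq ι], Set (Matrix ι ι V)

section Core

variable {V : Type} [AddCommGroup V] [Module ℂ V] [StarAddMonoid V] [StarModule ℂ V]

/-- conjugation `α* x α` of `x ∈ M_ι(V)` by a scalar matrix `α : M_{ι,κ}(ℂ)`. -/
def conjBy {ι κ : Type} [Fintype ι] (α : Matrix ι κ ℂ) (x : Matrix ι ι V) :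
    Matrix κ κ V :=
  Matrix.of fun s t => ∑ i, ∑ j, ((starRingEnd ℂ) (α i s) * α j t) • x i j

/-- `C` is a matrix ordering on the ∗-vector space `V`. -/
structure IsMatrixOrdering (C : ConeFamily V) : Prop where
  herm_mem : ∀ (ι : Type) [Fintype ι] [DecidableEq ι], ∀ x ∈ C ι, IsHermMat x
  add_mem : ∀ (ι : Type) [Fintype ι] [DecidableEq ι], ∀ x ∈ C ι, ∀ y ∈ C ι, x + y ∈ C ι
  smul_mem : ∀ (ι : Type) [Fintype ι] [DecidableEq ι], ∀ r : ℝ, 0 ≤ r → ∀ x ∈ C ι,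
    (r : ℂ) • x ∈ C ι
  conj_mem : ∀ (ι κ : Type) [Fintype ι] [DecidableEq ι] [Fintype κ] [DecidableEq κ],
    ∀ (α : Matrix ι κ ℂ), ∀ x ∈ C ι, conjBy α x ∈ C κ

/-- the diagonal matrix `I_ι ⊗ e` with `e` in every diagonal entry. -/
def unitMat {ι : Type} [DecidableEq ι] (e : V) : Matrix ι ι V :=
  Matrix.of fun i j => if i = j then e else 0

/-- membership of an element of `V` in the ground-level cone `C_1`. -/
def Mem1 (C : ConeFamily V) (v : V) : Prop :=
  (Matrix.of fun _ _ => v : Matrix (Fin 1) (Fin 1) V) ∈ C (Fin 1)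

/-- `(V, C, e)` is an (abstract) operator system: `C` is a proper matrix ordering and
`e` is an Archimedean matrix order unit. -/
structure IsOperatorSystem (C : ConeFamily V) (e : V) extends IsMatrixOrdering C : Prop where
  proper : ∀ (ι : Type) [Fintype ι] [DecidableEq ι], ∀ x ∈ C ι, -x ∈ C ι → x = 0
  unit_mem : Mem1 C e
  orderUnit : ∀ (ι : Type) [Fintype ι] [DecidableEq ι], ∀ x : Matrix ι ι V, IsHermMat x →
    ∃ t : ℝ, 0 < t ∧ (t : ℂ) • (unitMat e : Matrix ι ι V) - x ∈ C ι
  arch : ∀ (ι : Type) [Fintype ι] [DecidableEq ι], ∀ x : Matrix ι ι V,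
    (∀ ε : ℝ, 0 < ε → x + (ε : ℂ) • (unitMat e : Matrix ι ι V) ∈ C ι) → x ∈ C ι

/-- `p` is a positive contraction: `p ∈ C_1` and `e - p ∈ C_1`. -/
def IsPosCon (C : ConeFamily V) (e p : V) : Prop :=
  Mem1 C p ∧ Mem1 C (e - p)

/-- the `2 × 2` diagonal matrix `p ⊕ q` over `V`. -/
def diagPQ (p q : V) : Matrix (Fin 2) (Fin 2) V :=
  Matrix.of fun s t => if s = t then (if s = 0 then p else q) else 0

/-- `I_ι ⊗ y`. -/
def idKron {ι κ : Type} [DecidableEq ι] (y : Matrix κ κ V) : Matrix (ι × κ) (ι × κ) V :=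
  Matrix.of fun a b => if a.1 = b.1 then y a.2 b.2 else 0

/-- `x ⊗ J_κ`, the Kronecker product of `x` with the all-ones matrix. -/
def onesKron {ι κ : Type} (x : Matrix ι ι V) : Matrix (ι × κ) (ι × κ) V :=
  Matrix.of fun a b => x a.1 b.1

/-- the cone `C(p)_ι ⊆ M_{ι × 2}(V)` associated to a positive contraction `p`. -/
def coneP (C : ConeFamily V) (e p : V) (ι : Type) [Fintype ι] [DecidableEq ι] :
    Set (Matrix (ι × Fin 2) (ι × Fin 2) V) :=
  {x | IsHermMat x ∧ ∀ ε : ℝ, 0 < ε → ∃ t : ℝ, 0 < t ∧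
    x + (ε : ℂ) • idKron (diagPQ p (e - p)) + (t : ℂ) • idKron (diagPQ (e - p) p)
      ∈ C (ι × Fin 2)}

end Core

section Multi

variable {V : Type} [AddCommGroup V] [Module ℂ V] [StarAddMonoid V] [StarModule ℂ V] {N : ℕ}

/-- `P_k^N = I_{2^{k-1}} ⊗ (p_k ⊕ p_k^⊥) ⊗ J_{2^{N-k}}` as a matrix indexed by binary
strings of length `N` (the `j`-th bit corresponding to the `j`-th tensor factor of `2^N`). -/
def Pm (e : V) (p : Fin N → V) (k : Fin N) :
    Matrix (Fin N → Fin 2) (Fin N → Fin 2) V :=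
  Matrix.of fun σ τ =>
    if (∀ j, j < k → σ j = τ j) ∧ σ k = τ k then
      (if σ k = 0 then p k else e - p k) else 0

/-- `Q_k^N = I_{2^{k-1}} ⊗ (p_k^⊥ ⊕ p_k) ⊗ J_{2^{N-k}}`. -/
def Qm (e : V) (p : Fin N → V) (k : Fin N) :
    Matrix (Fin N → Fin 2) (Fin N → Fin 2) V :=
  Matrix.of fun σ τ =>
    if (∀ j, j < k → σ j = τ j) ∧ σ k = τ k then
      (if σ k = 0 then e - p k else p k) else 0

/-- `P̂_k^N = J_{2^{k-1}} ⊗ (p_k ⊕ p_k^⊥) ⊗ J_{2^{N-k}}`. -/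
def PmHat (e : V) (p : Fin N → V) (k : Fin N) :
    Matrix (Fin N → Fin 2) (Fin N → Fin 2) V :=
  Matrix.of fun σ τ =>
    if σ k = τ k then (if σ k = 0 then p k else e - p k) else 0

/-- `Q̂_k^N = J_{2^{k-1}} ⊗ (p_k^⊥ ⊕ p_k) ⊗ J_{2^{N-k}}`. -/
def QmHat (e : V) (p : Fin N → V) (k : Fin N) :
    Matrix (Fin N → Fin 2) (Fin N → Fin 2) V :=
  Matrix.of fun σ τ =>
    if σ k = τ k then (if σ k = 0 then e - p k else p k) else 0

/-- `x + Σ_k ε_k (I_ι ⊗ P_k^N) + Σ_k t_k (I_ι ⊗ Q_k^N) ∈ C_{ι·2^N}`. -/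
def MemMulti (C : ConeFamily V) (e : V) (p : Fin N → V)
    (ι : Type) [Fintype ι] [DecidableEq ι]
    (x : Matrix (ι × (Fin N → Fin 2)) (ι × (Fin N → Fin 2)) V) (ε t : Fin N → ℝ) : Prop :=
  x + ∑ k, (ε k : ℂ) • idKron (Pm e p k) + ∑ k, (t k : ℂ) • idKron (Qm e p k)
    ∈ C (ι × (Fin N → Fin 2))

/-- the cone `C(p_1, …, p_N)_ι ⊆ M_{ι·2^N}(V)`. -/
def coneMulti (C : ConeFamily V) (e : V) (p : Fin N → V)
    (ι : Type) [Fintype ι] [DecidableEq ι] :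
    Set (Matrix (ι × (Fin N → Fin 2)) (ι × (Fin N → Fin 2)) V) :=
  {x | IsHermMat x ∧ ∀ ε : Fin N → ℝ, (∀ i, 0 < ε i) →
    ∃ t : Fin N → ℝ, (∀ i, 0 < t i) ∧ MemMulti C e p ι x ε t ∧
      ∀ (i : Fin N) (ε' : ℝ), 0 < ε' → ε' < ε i →
        ∃ t' : ℝ, t i < t' ∧
          MemMulti C e p ι x (Function.update ε i ε') (Function.update t i t')}

/-- the `⊗J`-version of `MemMulti`, with `P̂`, `Q̂` in place of `P`, `Q`. -/
def MemMultiHat (C : ConeFamily V) (e : V) (p : Fin N → V)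
    (ι : Type) [Fintype ι] [DecidableEq ι]
    (x : Matrix (ι × (Fin N → Fin 2)) (ι × (Fin N → Fin 2)) V) (ε t : Fin N → ℝ) : Prop :=
  x + ∑ k, (ε k : ℂ) • idKron (PmHat e p k) + ∑ k, (t k : ℂ) • idKron (QmHat e p k)
    ∈ C (ι × (Fin N → Fin 2))

/-- the cone `Ĉ(p_1, …, p_N)_ι ⊆ M_{ι·2^N}(V)`. -/
def coneMultiHat (C : ConeFamily V) (e : V) (p : Fin N → V)
    (ι : Type) [Fintype ι] [DecidableEq ι] :
    Set (Matrix (ι × (Fin N → Fin 2)) (ι × (Fin N → Fin 2)) V) :=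
  {x | IsHermMat x ∧ ∀ ε : Fin N → ℝ, (∀ i, 0 < ε i) →
    ∃ t : Fin N → ℝ, (∀ i, 0 < t i) ∧ MemMultiHat C e p ι x ε t ∧
      ∀ (i : Fin N) (ε' : ℝ), 0 < ε' → ε' < ε i →
        ∃ t' : ℝ, t i < t' ∧
          MemMultiHat C e p ι x (Function.update ε i ε') (Function.update t i t')}

end Multi

section ConeLemmas

variable {V : Type} [AddCommGroup V] [Module ℂ V] [StarAddMonoid V]
  {C : ConeFamily V}

theorem IsMatrixOrdering.sum_mem (hC : IsMatrixOrdering C) {v : V} (hv : Mem1 C v)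
    {κ m : Type} [Fintype κ] [DecidableEq κ] (s : Finset m) (f : m → Matrix κ κ V)
    (hf : ∀ i ∈ s, f i ∈ C κ) : ∑ i ∈ s, f i ∈ C κ := by
  classical
  induction s using Finset.induction_on with
  | empty =>
    have h := hC.conj_mem (Fin 1) κ 0 _ hv
    have h0 : conjBy (0 : Matrix (Fin 1) κ ℂ) (Matrix.of fun _ _ => v) = 0 := by
      ext i j; simp [conjBy]
    rw [h0] at h
    simpa using h
  | insert a s ha ih =>
    rw [Finset.sum_insert ha]
    exact hC.add_mem _ _ (hf a (Finset.mem_insert_self a s)) _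
      (ih fun i hi => hf i (Finset.mem_insert_of_mem hi))

/-- A weighted indicator matrix of an equivalence relation, tensored with a positive element,
is positive. -/
theorem IsMatrixOrdering.gram_mem (hC : IsMatrixOrdering C) {v : V} (hv : Mem1 C v)
    {κ m : Type} [Fintype κ] [DecidableEq κ] [Fintype m] [DecidableEq m]
    (c : κ → m) (w : κ → ℝ) :
    (Matrix.of fun a b => if c a = c b then ((w a * w b : ℝ) : ℂ) • v else 0 :
      Matrix κ κ V) ∈ C κ := by
  have h : (Matrix.of fun a b => if c a = c b then ((w a * w b : ℝ) : ℂ) • v else 0 :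
      Matrix κ κ V) = ∑ i : m, conjBy
        (Matrix.of fun (_ : Fin 1) a => if c a = i then (w a : ℂ) else 0)
        (Matrix.of fun _ _ => v) := by
    ext a b
    rw [Matrix.sum_apply, Finset.sum_eq_single (c a)]
    · by_cases hab : c a = c b
      · simp [conjBy, hab]
      · simp [conjBy, hab, Ne.symm hab]
    · intro i _ hi
      simp [conjBy, Ne.symm hi]
    · simp
  rw [h]
  exact hC.sum_mem hv _ _ fun i _ => hC.conj_mem _ _ _ _ hv

end ConeLemmas

theorem Qm_eq_Pm {V : Type} [AddCommGroup V] {N : ℕ} (e : V) (p : Fin N → V) (k : Fin N) :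
    Qm e p k = Pm e (fun i => e - p i) k := by
  ext σ τ
  simp [Qm, Pm]

/-- The first index together with the bits up to `k`. -/
def headClass {ι : Type} {N : ℕ} (k : Fin N) (a : ι × (Fin N → Fin 2)) :
    ι × ({j : Fin N // j ≤ k} → Fin 2) :=
  (a.1, fun j => a.2 j)

theorem headClass_eq_iff {ι : Type} {N : ℕ} (k : Fin N) (a b : ι × (Fin N → Fin 2)) :
    headClass k a = headClass k b ↔
      a.1 = b.1 ∧ (∀ j, j < k → a.2 j = b.2 j) ∧ a.2 k = b.2 k := by
  simp only [headClass, Prod.mk.injEq, funext_iff, Subtype.forall]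
  refine and_congr_right fun _ => ⟨fun h => ⟨fun j hj => h j hj.le, h k le_rfl⟩, fun h j hj => ?_⟩
  rcases hj.lt_or_eq with hj | rfl
  exacts [h.1 j hj, h.2]

theorem headClass_eq_iff_eq {ι : Type} {N : ℕ} {L : Fin N} (hL : ∀ k, k ≤ L)
    (a b : ι × (Fin N → Fin 2)) : headClass L a = headClass L b ↔ a = b := by
  simp [headClass, Prod.ext_iff, funext_iff, hL]

theorem headClass_eq_and_iff_eq {ι : Type} {N : ℕ} {L j : Fin N} (hL : ∀ k, k ≤ L)
    (hj : ∀ k, k < L → k ≤ j) (a b : ι × (Fin N → Fin 2)) :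
    headClass j a = headClass j b ∧ a.2 L = b.2 L ↔ a = b := by
  refine ⟨fun ⟨h, h'⟩ => ?_, by rintro rfl; simp⟩
  simp only [headClass, Prod.mk.injEq, funext_iff, Subtype.forall] at h
  refine Prod.ext h.1 (funext fun k => ?_)
  rcases (hL k).lt_or_eq with hk | rfl
  exacts [h.2 k (hj k hk), h']

theorem idKron_Qm_apply {V ι : Type} [AddCommGroup V] [DecidableEq ι] {N : ℕ}
    (e : V) (p : Fin N → V) (k : Fin N) (a b : ι × (Fin N → Fin 2)) :
    idKron (Qm e p k) a b = if headClass k a = headClass k b then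
      (if a.2 k = 0 then e - p k else p k) else 0 := by
  simp only [idKron, Qm, Matrix.of_apply, headClass_eq_iff, ite_and]

theorem idKron_Pm_add_idKron_Qm {V ι : Type} [AddCommGroup V] [DecidableEq ι] {N : ℕ}
    (e : V) (p : Fin N → V) (k : Fin N) :
    (idKron (Pm e p k) + idKron (Qm e p k) :
      Matrix (ι × (Fin N → Fin 2)) (ι × (Fin N → Fin 2)) V) =
      Matrix.of fun a b => if headClass k a = headClass k b then e else 0 := by
  ext a b
  simp only [Matrix.add_apply, idKron, Pm, Qm, Matrix.of_apply, headClass_eq_iff, ite_and]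
  split_ifs <;> simp

theorem IsPosCon.compl {V : Type} [AddCommGroup V] {C : ConeFamily V} {e : V} {N : ℕ}
    {p : Fin N → V} (hp : ∀ i, IsPosCon C e (p i)) (i : Fin N) :
    IsPosCon C e (e - p i) :=
  ⟨(hp i).2, by simpa using (hp i).1⟩

section Multi

variable {V : Type} [AddCommGroup V] [Module ℂ V] [StarAddMonoid V]
  {C : ConeFamily V} {e : V} {N : ℕ} {p : Fin N → V} {ι : Type} [Fintype ι] [DecidableEq ι]

theorem idKron_Pm_mem (hC : IsMatrixOrdering C) (hp : ∀ i, IsPosCon C e (p i)) (k : Fin N) :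
    (idKron (Pm e p k) : Matrix (ι × (Fin N → Fin 2)) (ι × (Fin N → Fin 2)) V) ∈ C _ := by
  have h := hC.add_mem _ _
    (hC.gram_mem (hp k).1 (headClass (ι := ι) k) fun a => if a.2 k = 0 then 1 else 0) _
    (hC.gram_mem (hp k).2 (headClass (ι := ι) k) fun a => if a.2 k = 0 then 0 else 1)
  convert h using 1
  ext a b
  simp only [idKron, Pm, Matrix.of_apply, Matrix.add_apply, headClass_eq_iff]
  by_cases h1 : a.1 = b.1
  · by_cases h2 : (∀ j, j < k → a.2 j = b.2 j) ∧ a.2 k = b.2 k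
    · by_cases h3 : a.2 k = 0
      · have h4 : b.2 k = 0 := h2.2 ▸ h3
        simp [h1, h2, h4]
      · have h4 : b.2 k ≠ 0 := h2.2 ▸ h3
        simp [h1, h2, h4]
    · simp [h1, h2]
  · simp [h1]

theorem idKron_Qm_mem (hC : IsMatrixOrdering C) (hp : ∀ i, IsPosCon C e (p i)) (k : Fin N) :
    (idKron (Qm e p k) : Matrix (ι × (Fin N → Fin 2)) (ι × (Fin N → Fin 2)) V) ∈ C _ := by
  rw [Qm_eq_Pm]
  exact idKron_Pm_mem hC (IsPosCon.compl hp) k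

theorem MemMulti.mono (hC : IsMatrixOrdering C) (hp : ∀ i, IsPosCon C e (p i))
    {x : Matrix (ι × (Fin N → Fin 2)) (ι × (Fin N → Fin 2)) V} {ε ε' t t' : Fin N → ℝ}
    (h : MemMulti C e p ι x ε t) (hε : ε ≤ ε') (ht : t ≤ t') : MemMulti C e p ι x ε' t' := by
  rcases isEmpty_or_nonempty (Fin N) with hN | ⟨⟨k⟩⟩
  · have h1 : ε' = ε := Subsingleton.elim _ _
    have h2 : t' = t := Subsingleton.elim _ _
    rwa [h1, h2]
  have hP := hC.sum_mem (hp k).1 Finset.univ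
    (fun k => ((ε' k - ε k : ℝ) : ℂ) • (idKron (Pm e p k) : Matrix (ι × _) (ι × _) V))
    fun k _ => hC.smul_mem _ _ (sub_nonneg.2 (hε k)) _ (idKron_Pm_mem hC hp k)
  have hQ := hC.sum_mem (hp k).1 Finset.univ
    (fun k => ((t' k - t k : ℝ) : ℂ) • (idKron (Qm e p k) : Matrix (ι × _) (ι × _) V))
    fun k _ => hC.smul_mem _ _ (sub_nonneg.2 (ht k)) _ (idKron_Qm_mem hC hp k)
  have := hC.add_mem _ _ (hC.add_mem _ _ h _ hP) _ hQ
  unfold MemMulti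
  convert this using 1
  simp only [Complex.ofReal_sub, sub_smul, Finset.sum_sub_distrib]
  abel

theorem MemMulti.of_mem (hC : IsMatrixOrdering C) (hp : ∀ i, IsPosCon C e (p i))
    {x : Matrix (ι × (Fin N → Fin 2)) (ι × (Fin N → Fin 2)) V} (hx : x ∈ C _)
    {ε t : Fin N → ℝ} (hε : 0 ≤ ε) (ht : 0 ≤ t) : MemMulti C e p ι x ε t := by
  refine MemMulti.mono hC hp (ε := 0) (t := 0) ?_ hε ht
  simpa [MemMulti] using hx

theorem mem_coneMulti_of_mem (hC : IsMatrixOrdering C) (hp : ∀ i, IsPosCon C e (p i))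
    {x : Matrix (ι × (Fin N → Fin 2)) (ι × (Fin N → Fin 2)) V} (hx : x ∈ C _) :
    x ∈ coneMulti C e p ι := by
  refine ⟨hC.herm_mem _ x hx, fun ε hε => ⟨1, fun _ => one_pos, ?_, fun i ε' h0 _ =>
    ⟨2, one_lt_two, ?_⟩⟩⟩
  · exact .of_mem hC hp hx (fun i => (hε i).le) zero_le_one
  · refine .of_mem hC hp hx (fun k => ?_) fun k => ?_
    · rcases eq_or_ne k i with rfl | hk
      · simpa using h0.le
      · simpa [hk] using (hε k).le
    · rcases eq_or_ne k i with rfl | hk <;> simp [*]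

/-- If `L` is the last index and `j` is the last or the second to last one, then
`P_j + Q_j + (3/2) Q_L` dominates half the unit. -/
theorem absorb_unit_mem (hC : IsMatrixOrdering C) (hp : ∀ i, IsPosCon C e (p i)) {L j : Fin N}
    (hL : ∀ k, k ≤ L) (hj : ∀ k, k < L → k ≤ j) :
    ((idKron (Pm e p j) + idKron (Qm e p j) + ((3 / 2 : ℝ) : ℂ) • idKron (Qm e p L)
      - ((1 / 2 : ℝ) : ℂ) • unitMat e : Matrix (ι × (Fin N → Fin 2)) (ι × (Fin N → Fin 2)) V))
      ∈ C _ := by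
  rcases (hL j).lt_or_eq with hjL | rfl
  · have h := hC.smul_mem _ (1 / 2) (by norm_num) _ <| hC.add_mem _ _
      (hC.gram_mem (hp L).1 (headClass (ι := ι) j) fun a => if a.2 L = 0 then 1 else 2) _
      (hC.gram_mem (hp L).2 (headClass (ι := ι) j) fun a => if a.2 L = 0 then 2 else 1)
    convert h using 1
    ext a b
    simp only [idKron_Pm_add_idKron_Qm, Matrix.add_apply, Matrix.sub_apply, Matrix.smul_apply,
      Matrix.of_apply, idKron_Qm_apply, unitMat, headClass_eq_iff_eq hL,
      ← headClass_eq_and_iff_eq hL hj a b]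
    by_cases h1 : headClass j a = headClass j b
    · by_cases h2 : a.2 L = b.2 L
      · by_cases h3 : b.2 L = 0
        · simp only [h1, h2, h3, and_self, if_true]
          push_cast
          module
        · simp only [h1, h2, h3, and_self, if_true, if_false]
          push_cast
          module
      · by_cases h3 : a.2 L = 0
        · have h4 : b.2 L ≠ 0 := fun h => h2 (h3.trans h.symm)
          simp only [h1, h3, h4, h4.symm, and_false, if_true, if_false]
          push_cast
          module
        · have h4 : b.2 L = 0 := by omega
          simp only [h1, h3, h4, and_false, if_true, if_false]
          push_cast
          module
    · simp [h1]
  · have h := hC.add_mem _ _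
      (hC.smul_mem _ (1 / 2) (by norm_num) _
        (hC.add_mem _ _ (idKron_Pm_mem (ι := ι) hC hp j) _ (idKron_Qm_mem hC hp j))) _
      (hC.smul_mem _ (3 / 2) (by norm_num) _ (idKron_Qm_mem hC hp j))
    convert h using 1
    have hu : (unitMat e : Matrix (ι × (Fin N → Fin 2)) (ι × (Fin N → Fin 2)) V)
        = idKron (Pm e p j) + idKron (Qm e p j) := by
      rw [idKron_Pm_add_idKron_Qm]
      ext a b
      simp [unitMat, headClass_eq_iff_eq hL]
    rw [hu]
    push_cast
    module

theorem MemMulti.absorb_unit (hC : IsMatrixOrdering C) (hp : ∀ i, IsPosCon C e (p i))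
    {L j : Fin N} (hL : ∀ k, k ≤ L) (hj : ∀ k, k < L → k ≤ j)
    {x : Matrix (ι × (Fin N → Fin 2)) (ι × (Fin N → Fin 2)) V} {ε ε' t t' : Fin N → ℝ} {δ : ℝ}
    (hδ : 0 ≤ δ) (h : MemMulti C e p ι (x + (δ : ℂ) • unitMat e) ε t)
    (hε : ε ≤ ε') (hεj : ε j + 2 * δ ≤ ε' j) (ht : ∀ k, t k + 5 * δ ≤ t' k) :
    MemMulti C e p ι x ε' t' := by
  have h1 : MemMulti C e p ι x (ε + Pi.single j (2 * δ))
      (t + Pi.single j (2 * δ) + Pi.single L (3 * δ)) := by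
    have := hC.add_mem _ _ h _ (hC.smul_mem _ (2 * δ) (by positivity) _
      (absorb_unit_mem hC hp hL hj))
    unfold MemMulti
    convert this using 1
    have hs : ∀ (k : Fin N) (c : ℝ) (F : Fin N → Matrix (ι × (Fin N → Fin 2)) (ι × (Fin N → Fin 2)) V),
        ∑ i, ((Pi.single (M := fun _ => ℝ) k c i : ℝ) : ℂ) • F i = (c : ℂ) • F k := by
      intro k c F
      rw [Finset.sum_eq_single k] <;> simp +contextual
    simp only [Pi.add_apply, Complex.ofReal_add, add_smul, Finset.sum_add_distrib, hs]
    push_cast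
    module
  refine h1.mono hC hp (fun k => ?_) fun k => ?_
  · rcases eq_or_ne k j with rfl | hk
    · simpa using hεj
    · simpa [hk] using hε k
  · have := ht k
    simp only [Pi.add_apply, Pi.single_apply]
    split_ifs <;> linarith

end Multi

/-- `I_{2^N} ⊗ e` is an Archimedean matrix order unit for
`(M_{2^N}(V), C(p_1, …, p_N))`. -/
theorem stmt_5 {V : Type} [AddCommGroup V] [Module ℂ V] [StarAddMonoid V] [StarModule ℂ V]
    (C : ConeFamily V) (e : V) (hos : IsOperatorSystem C e)
    {N : ℕ} (hN : 1 ≤ N) (p : Fin N → V) (hp : ∀ i, IsPosCon C e (p i)) :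
    (∀ (ι : Type) [Fintype ι] [DecidableEq ι],
      ∀ x : Matrix (ι × (Fin N → Fin 2)) (ι × (Fin N → Fin 2)) V, IsHermMat x →
        ∃ t : ℝ, 0 < t ∧ x + (t : ℂ) • unitMat e ∈ coneMulti C e p ι) ∧
    (∀ (ι : Type) [Fintype ι] [DecidableEq ι],
      ∀ x : Matrix (ι × (Fin N → Fin 2)) (ι × (Fin N → Fin 2)) V, IsHermMat x →
        (∀ ε : ℝ, 0 < ε → x + (ε : ℂ) • unitMat e ∈ coneMulti C e p ι) →
          x ∈ coneMulti C e p ι) := by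
  have hC := hos.toIsMatrixOrdering
  refine ⟨fun ι _ _ x hx => ?_, fun ι _ _ x hx h => ⟨hx, fun ε hε => ?_⟩⟩
  · obtain ⟨t, ht, hm⟩ := hos.orderUnit _ (-x) fun i j => by simp [hx i j]
    refine ⟨t, ht, mem_coneMulti_of_mem hC hp ?_⟩
    rwa [sub_neg_eq_add, add_comm] at hm
  obtain ⟨n, rfl⟩ : ∃ n, N = n + 1 := ⟨N - 1, by omega⟩
  have hL : ∀ k, k ≤ Fin.last n := Fin.le_last
  obtain ⟨a, ha, haε⟩ : ∃ a : ℝ, 0 < a ∧ ∀ k, 4 * a ≤ ε k := by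
    obtain ⟨k, hk⟩ := Finite.exists_min ε
    exact ⟨ε k / 4, by linarith [hε k], fun i => by linarith [hk i]⟩
  obtain ⟨t, ht, hm, hs⟩ := (h a ha).2 (fun k => ε k / 2) fun k => half_pos (hε k)
  have hm' : MemMulti C e p ι x ε (fun k => t k + 5 * a) :=
    hm.absorb_unit hC hp hL (fun k hk => hk.le) ha.le
      (fun k => by simpa using (hε k).le) (by linarith [haε (Fin.last n)]) fun k => le_rfl
  refine ⟨fun k => t k + 5 * a, fun k => by linarith [ht k], hm', fun i ε' h0 h1 => ?_⟩
  rcases Nat.eq_zero_or_pos n with rfl | hn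
  · obtain ⟨s, -, hms, -⟩ := (h (ε' / 4) (by linarith)).2 (fun _ => ε' / 2) fun _ => half_pos h0
    have hi : ∀ k, k = i := fun k => Fin.subsingleton_one.elim k i
    refine ⟨max (s i + 5 * (ε' / 4)) (t i + 5 * a + 1),
      lt_of_lt_of_le (lt_add_one _) (le_max_right _ _), ?_⟩
    refine hms.absorb_unit hC hp hL (fun k hk => hk.le) (by linarith) (fun k => ?_) ?_ fun k => ?_
    · rw [hi k]; simpa using h0.le
    · rw [hi (Fin.last 0)]; simp; linarith
    · rw [hi k]; simp
  · obtain ⟨j, hji, hj⟩ : ∃ j : Fin (n + 1), j ≠ i ∧ ∀ k, k < Fin.last n → k ≤ j := by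
      by_cases hi : i = Fin.last n
      · refine ⟨⟨n - 1, by omega⟩, ?_, fun k hk => ?_⟩
        · rw [hi, Ne, Fin.ext_iff, Fin.val_last]; simp only; omega
        · rw [Fin.lt_def, Fin.val_last] at hk; rw [Fin.le_def]; simp only; omega
      · exact ⟨_, Ne.symm hi, fun k hk => hk.le⟩
    have hεi := hε i
    obtain ⟨s, hts, hms⟩ := hs i (min ε' (ε i / 4)) (lt_min h0 (by linarith))
      (lt_of_le_of_lt (min_le_right _ _) (by linarith))
    refine ⟨s + 5 * a, by linarith, hms.absorb_unit hC hp hL hj ha.le (fun k => ?_) ?_ fun k => ?_⟩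
    · rcases eq_or_ne k i with rfl | hk
      · simp
      · simpa [hk] using (hε k).le
    · simp only [ne_eq, hji, not_false_eq_true, Function.update_of_ne]
      linarith [haε j]
    · rcases eq_or_ne k i with rfl | hk <;> simp [*]
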